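/- arXiv:2211.02039 — 3 statements merged into one kernel-verified Lean document; each statement's English description precedes it below -/
import Mathlib

section
/- Let Φ be the distribution function of the standard normal distribution N(0,1), let α ∈ (0, 1/2), let z_α := Φ⁻¹(α), and let c, d > 0. Define ψ : ℝ → ℝ by ψ(β) := Φ(cβ) · Φ(z_α + dβ) + Φ(−cβ) · Φ(z_α − dβ). Then ψ(β) ≥ α for all β ∈ ℝ, with equality if and only if β = 0. -/
open MeasureTheory ProbabilityTheory

/-- The distribution function `Φ` of the standard normal distribution `N(0,1)`. -/
noncomputable def stdGaussianCDF (x : ℝ) : ℝ :=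
  ((ProbabilityTheory.gaussianReal 0 1) (Set.Iic x)).toReal

lemma cdf_sub (a b : ℝ) (hab : a ≤ b) :
    stdGaussianCDF b - stdGaussianCDF a = ∫ x in a..b, gaussianPDFReal 0 1 x := by
  have key : ∀ x, stdGaussianCDF x = ∫ t in Set.Iic x, gaussianPDFReal 0 1 t := by
    intro x
    unfold stdGaussianCDF
    rw [gaussianReal_apply_eq_integral 0 one_ne_zero, ENNReal.toReal_ofReal]
    exact integral_nonneg fun t => gaussianPDFReal_nonneg 0 1 t
  rw [key, key]
  exact intervalIntegral.integral_Iic_sub_Iic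
    (integrable_gaussianPDFReal 0 1).integrableOn (integrable_gaussianPDFReal 0 1).integrableOn

lemma pdf_cont : Continuous (gaussianPDFReal 0 1) := by
  unfold gaussianPDFReal
  fun_prop

lemma cdf_strictMono : StrictMono stdGaussianCDF := by
  intro a b hab
  have h := cdf_sub a b hab.le
  have : 0 < ∫ x in a..b, gaussianPDFReal 0 1 x :=
    intervalIntegral.intervalIntegral_pos_of_pos (pdf_cont.intervalIntegrable a b)
      (fun x => gaussianPDFReal_pos 0 1 x one_ne_zero) hab
  linarith

lemma cdf_neg (x : ℝ) : stdGaussianCDF (-x) = 1 - stdGaussianCDF x := by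
  have h1 : gaussianReal 0 1 (Set.Iic (-x)) = gaussianReal 0 1 (Set.Ici x) := by
    have h := gaussianReal_map_neg (μ := 0) (v := 1)
    rw [neg_zero] at h
    conv_lhs => rw [← h]
    rw [Measure.map_apply measurable_neg measurableSet_Iic]
    simp
  have h2 : gaussianReal 0 1 (Set.Ici x) = gaussianReal 0 1 (Set.Ioi x) := by
    have : NullSingletonClass (gaussianReal 0 1) := nullSingletonClass_gaussianReal one_ne_zero
    exact measure_congr Ioi_ae_eq_Ici.symm
  unfold stdGaussianCDF
  rw [h1, h2, ← Set.compl_Iic]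
  exact probReal_compl_eq_one_sub measurableSet_Iic

lemma cdf_mid (z t : ℝ) (hz : z ≤ 0) (ht : 0 ≤ t) :
    2 * stdGaussianCDF z ≤ stdGaussianCDF (z + t) + stdGaussianCDF (z - t) := by
  have h1 := cdf_sub z (z + t) (by linarith)
  have h2 := cdf_sub (z - t) z (by linarith)
  have e1 : ∫ s in (0:ℝ)..t, gaussianPDFReal 0 1 (z + s)
      = ∫ x in z..(z + t), gaussianPDFReal 0 1 x := by
    rw [intervalIntegral.integral_comp_add_left (gaussianPDFReal 0 1)]; simp
  have e2 : ∫ s in (0:ℝ)..t, gaussianPDFReal 0 1 (z - s)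
      = ∫ x in (z - t)..z, gaussianPDFReal 0 1 x := by
    rw [intervalIntegral.integral_comp_sub_left (gaussianPDFReal 0 1)]; simp
  have h3 : ∫ s in (0:ℝ)..t, gaussianPDFReal 0 1 (z - s)
      ≤ ∫ s in (0:ℝ)..t, gaussianPDFReal 0 1 (z + s) := by
    apply intervalIntegral.integral_mono_on ht
    · exact (pdf_cont.comp (by fun_prop)).intervalIntegrable _ _
    · exact (pdf_cont.comp (by fun_prop)).intervalIntegrable _ _
    · intro s hs
      unfold gaussianPDFReal
      have : z * s ≤ 0 := mul_nonpos_of_nonpos_of_nonneg hz hs.1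
      gcongr ?_ * Real.exp (-?_ / ?_)
      nlinarith
  linarith

lemma psi_pos (z a t : ℝ) (hz : z ≤ 0) (ha : 0 < a) (ht : 0 < t) :
    stdGaussianCDF z < stdGaussianCDF a * stdGaussianCDF (z + t)
      + stdGaussianCDF (-a) * stdGaussianCDF (z - t) := by
  have h0 := cdf_neg 0
  rw [neg_zero] at h0
  have h1 := cdf_strictMono ha
  have h2 := cdf_mid z t hz ht.le
  have h3 : stdGaussianCDF (z - t) < stdGaussianCDF (z + t) := cdf_strictMono (by linarith)
  rw [cdf_neg a]
  nlinarith [mul_pos (show 0 < stdGaussianCDF a - 1 / 2 by linarith) (sub_pos.2 h3)]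

/-- For `α ∈ (0, 1/2)`, `z_α := Φ⁻¹(α)` and `c, d > 0`, the function
`ψ(β) := Φ(cβ)Φ(z_α + dβ) + Φ(−cβ)Φ(z_α − dβ)` satisfies `ψ(β) ≥ α` for all `β`, with
equality if and only if `β = 0`. -/
theorem stmt7 (α : ℝ) (hα : α ∈ Set.Ioo (0 : ℝ) (1 / 2))
    (z : ℝ) (hz : stdGaussianCDF z = α)
    (c d : ℝ) (hc : 0 < c) (hd : 0 < d) :
    ∀ β : ℝ,
      α ≤ stdGaussianCDF (c * β) * stdGaussianCDF (z + d * β)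
          + stdGaussianCDF (-(c * β)) * stdGaussianCDF (z - d * β) ∧
      (stdGaussianCDF (c * β) * stdGaussianCDF (z + d * β)
          + stdGaussianCDF (-(c * β)) * stdGaussianCDF (z - d * β) = α ↔ β = 0) := by
  have h0 := cdf_neg 0
  rw [neg_zero] at h0
  have hz0 : z < 0 := by
    apply cdf_strictMono.lt_iff_lt.1
    have := hα.2
    linarith
  intro β
  rcases lt_trichotomy β 0 with hb | hb | hb
  · have h := psi_pos z (c * -β) (d * -β) hz0.le (mul_pos hc (by linarith))
      (mul_pos hd (by linarith))
    simp only [mul_neg, neg_neg, sub_neg_eq_add, ← sub_eq_add_neg] at h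
    refine ⟨by linarith, fun h' => by linarith, fun h' => absurd h' hb.ne⟩
  · subst hb
    have : stdGaussianCDF 0 = 1 / 2 := by linarith
    simp only [mul_zero, neg_zero, add_zero, sub_zero, this, hz]
    exact ⟨by linarith, fun _ => trivial, fun _ => by ring⟩
  · have h := psi_pos z (c * β) (d * β) hz0.le (mul_pos hc hb) (mul_pos hd hb)
    refine ⟨by linarith, fun h' => by linarith, fun h' => absurd h' hb.ne'⟩
end

section
/- Let (Ω, ℱ) be a measurable space equipped with a family of probability measures (ℙ_P)_{P∈𝒫}, let (X_n)_{n∈ℕ} be real random variables on (Ω, ℱ) with each X_n ℙ_P-integrable for every P, and let (ℱ_n)_{n∈ℕ} be sub-σ-algebras of ℱ. Let (a_{P,n}) be positive real numbers, possibly depending on P. If E_P(|X_n| | ℱ_n) = O_𝒫(a_{P,n}), then X_n = O_𝒫(a_{P,n}). -/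
open MeasureTheory Filter

/-- `X_{P,n} = O_𝒫(1)`: for every `ε > 0` there exist `M_ε > 0` and `N_ε` such that
`sup_{n ≥ N_ε} sup_{P∈𝒫} ℙ_P(|X_{P,n}| > M_ε) < ε`. -/
def bigOP {Ω ι : Type*} [MeasurableSpace Ω] (ℙ : ι → Measure Ω)
    (X : ι → ℕ → Ω → ℝ) : Prop :=
  ∀ ε : ℝ, 0 < ε → ∃ M : ℝ, 0 < M ∧ ∃ N : ℕ, ∀ n ≥ N, ∀ P,
    (ℙ P) {ω | M < |X P n ω|} < ENNReal.ofReal ε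

/-- unconditionalisation via Markov.  If the conditional expectations
`E_P(|X_n| | ℱ_n)` are `O_𝒫(a_{P,n})` (with `a_{P,n} > 0`, i.e. the ratios
`E_P(|X_n| | ℱ_n)/a_{P,n}` are `O_𝒫(1)`), then `X_n = O_𝒫(a_{P,n})`. -/
theorem stmt9 {Ω ι : Type*} [m0 : MeasurableSpace Ω] (ℙ : ι → Measure Ω)
    [∀ P, IsProbabilityMeasure (ℙ P)]
    (X : ℕ → Ω → ℝ) (hmeas : ∀ n, Measurable (X n))
    (ℱ : ℕ → MeasurableSpace Ω) (hℱ : ∀ n, ℱ n ≤ m0)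
    (hint : ∀ P n, Integrable (X n) (ℙ P))
    (a : ι → ℕ → ℝ) (ha : ∀ P n, 0 < a P n)
    (hhyp : bigOP ℙ (fun P n ω => ((ℙ P)[fun ω' => |X n ω'| | ℱ n]) ω / a P n)) :
    bigOP ℙ (fun P n ω => X n ω / a P n) := by
  intro ε hε
  obtain ⟨M, hM, N, hN⟩ := hhyp (ε / 2) (by positivity)
  refine ⟨2 * M / ε, by positivity, N, fun n hn P => ?_⟩
  have h1 := hN n hn P
  have hapos := ha P n
  set G : Ω → ℝ := (ℙ P)[fun ω' => |X n ω'| | ℱ n] with hG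
  have hGm : Measurable[ℱ n] G := stronglyMeasurable_condExp.measurable
  have hSm : MeasurableSet[ℱ n] {ω | G ω ≤ M * a P n} := hGm measurableSet_Iic
  set S : Set Ω := {ω | G ω ≤ M * a P n} with hS
  have hSm0 : MeasurableSet S := hℱ n _ hSm
  have hXi : Integrable (fun ω' => |X n ω'|) (ℙ P) := (hint P n).abs
  have hI : ∫ ω in S, |X n ω| ∂(ℙ P) ≤ M * a P n := by
    rw [← setIntegral_condExp (hℱ n) hXi hSm]
    calc ∫ ω in S, G ω ∂(ℙ P) ≤ ∫ ω in S, M * a P n ∂(ℙ P) := by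
          apply setIntegral_mono_on integrable_condExp.integrableOn
            (integrable_const _).integrableOn hSm0
          intro ω hω
          exact hω
      _ = (ℙ P).real S * (M * a P n) := by
          rw [setIntegral_const, smul_eq_mul]
      _ ≤ 1 * (M * a P n) := by
          gcongr
          exact measureReal_le_one
      _ = M * a P n := one_mul _
  have hMk := mul_meas_ge_le_integral_of_nonneg (μ := (ℙ P).restrict S)
    (f := fun ω => |X n ω|) (Eventually.of_forall fun ω => abs_nonneg _)
    hXi.integrableOn (2 * M / ε * a P n)
  have hT : ((ℙ P).restrict S).real {ω | 2 * M / ε * a P n ≤ |X n ω|} ≤ ε / 2 := by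
    have hK : 0 < 2 * M / ε * a P n := by positivity
    refine le_of_mul_le_mul_left (hMk.trans (hI.trans (le_of_eq ?_))) hK
    field_simp
  have hT' : ((ℙ P).restrict S) {ω | 2 * M / ε * a P n ≤ |X n ω|} ≤ ENNReal.ofReal (ε / 2) := by
    rw [← ofReal_measureReal]
    exact ENNReal.ofReal_le_ofReal hT
  have hsub : {ω | 2 * M / ε < |X n ω / a P n|} ⊆
      {ω | M < |G ω / a P n|} ∪ ({ω | 2 * M / ε * a P n ≤ |X n ω|} ∩ S) := by
    intro ω hω
    by_cases h : ω ∈ S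
    · right
      refine ⟨?_, h⟩
      simp only [Set.mem_setOf_eq, abs_div, abs_of_pos hapos, lt_div_iff₀ hapos] at hω
      exact hω.le
    · left
      simp only [hS, Set.mem_setOf_eq, not_le] at h
      exact ((lt_div_iff₀ hapos).2 h).trans_le (le_abs_self _)
  calc (ℙ P) {ω | 2 * M / ε < |X n ω / a P n|}
      ≤ (ℙ P) {ω | M < |G ω / a P n|}
        + (ℙ P) ({ω | 2 * M / ε * a P n ≤ |X n ω|} ∩ S) :=
        (measure_mono hsub).trans (measure_union_le _ _)
    _ < ENNReal.ofReal (ε / 2) + ENNReal.ofReal (ε / 2) := by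
        rw [Measure.restrict_apply' hSm0] at hT'
        exact ENNReal.add_lt_add_of_lt_of_le (ne_top_of_le_ne_top ENNReal.ofReal_ne_top hT') h1 hT'
    _ = ENNReal.ofReal ε := by
        rw [← ENNReal.ofReal_add (by positivity) (by positivity), add_halves]
end

section
/- Let (Ω, ℱ) be a measurable space equipped with a family of probability measures (ℙ_P)_{P∈𝒫}, let (X_{P,n})_{n∈ℕ} be a family of real random variables and (X_P) another family of real random variables on (Ω, ℱ), and assume |X_{P,n} − X_P| = o_𝒫(1). Let h : ℝ → ℝ be continuous, and suppose at least one of the following holds: (i) h is uniformly continuous; (ii) (X_P) is uniformly tight, i.e. lim_{M→∞} sup_{P∈𝒫} ℙ_P(|X_P| > M) = 0. Then |h(X_{P,n}) − h(X_P)| = o_𝒫(1). -/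
open MeasureTheory Filter

/-- `X_{P,n} = o_𝒫(1)`: for every `ε > 0`, `sup_{P ∈ 𝒫} ℙ_P(|X_{P,n}| > ε) → 0` as `n → ∞`. -/
def smallOP {Ω ι : Type*} [MeasurableSpace Ω] (ℙ : ι → Measure Ω)
    (X : ι → ℕ → Ω → ℝ) : Prop :=
  ∀ ε : ℝ, 0 < ε →
    Tendsto (fun n => ⨆ P, (ℙ P) {ω | ε < |X P n ω|}) atTop (nhds 0)

/-- uniform continuous mapping.  Let `|X_{P,n} − X_P| = o_𝒫(1)` and let
`h : ℝ → ℝ` be continuous.  If either (i) `h` is uniformly continuous, or (ii) the family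
`(X_P)` is uniformly tight, i.e. `lim_{M→∞} sup_{P∈𝒫} ℙ_P(|X_P| > M) = 0`, then
`|h(X_{P,n}) − h(X_P)| = o_𝒫(1)`. -/
theorem stmt13 {Ω ι : Type*} [MeasurableSpace Ω] (ℙ : ι → Measure Ω)
    [∀ P, IsProbabilityMeasure (ℙ P)]
    (X : ι → ℕ → Ω → ℝ) (X' : ι → Ω → ℝ)
    (hconv : smallOP ℙ (fun P n ω => X P n ω - X' P ω))
    (h : ℝ → ℝ) (hcont : Continuous h)
    (halt : UniformContinuous h ∨
      Tendsto (fun M : ℝ => ⨆ P, (ℙ P) {ω | M < |X' P ω|}) atTop (nhds 0)) :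
    smallOP ℙ (fun P n ω => h (X P n ω) - h (X' P ω)) := by
  intro ε hε
  rcases halt with hu | ht
  · obtain ⟨δ, hδ, H⟩ := Metric.uniformContinuous_iff.1 hu ε hε
    refine tendsto_of_tendsto_of_tendsto_of_le_of_le tendsto_const_nhds
      (hconv (δ / 2) (by positivity)) (fun _ => zero_le) (fun n => ?_)
    refine iSup_mono fun P => measure_mono fun ω hω => ?_
    simp only [Set.mem_setOf_eq] at hω ⊢
    by_contra hc
    have h1 := @H (X P n ω) (X' P ω) (by rw [Real.dist_eq]; linarith)
    rw [Real.dist_eq] at h1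
    linarith
  · rw [ENNReal.tendsto_nhds_zero] at ht ⊢
    intro η hη
    have hη2 : 0 < η / 2 := ENNReal.half_pos hη.ne'
    obtain ⟨M, hM⟩ := (ht (η / 2) hη2).exists
    have hK : UniformContinuousOn h (Set.Icc (-(M + 1)) (M + 1)) :=
      isCompact_Icc.uniformContinuousOn_of_continuous hcont.continuousOn
    obtain ⟨δ, hδ, H⟩ := Metric.uniformContinuousOn_iff.1 hK ε hε
    have hd : 0 < min (δ / 2) 1 := by positivity
    have hc := ENNReal.tendsto_nhds_zero.1 (hconv _ hd) (η / 2) hη2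
    filter_upwards [hc] with n hn
    refine iSup_le fun P => ?_
    have hsub : {ω | ε < |h (X P n ω) - h (X' P ω)|} ⊆
        {ω | min (δ / 2) 1 < |X P n ω - X' P ω|} ∪ {ω | M < |X' P ω|} := by
      intro ω hω
      simp only [Set.mem_setOf_eq, Set.mem_union] at hω ⊢
      by_contra hcon
      push Not at hcon
      obtain ⟨ha, hb⟩ := hcon
      have h1 := ha.trans (min_le_left _ _)
      have h2 := abs_le.1 (ha.trans (min_le_right _ _))
      have h3 := abs_le.1 hb
      have h4 := H (X P n ω) ⟨by linarith, by linarith⟩ (X' P ω)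
        ⟨by linarith, by linarith⟩ (by rw [Real.dist_eq]; linarith)
      rw [Real.dist_eq] at h4
      linarith
    calc (ℙ P) {ω | ε < |h (X P n ω) - h (X' P ω)|}
        ≤ _ := measure_mono hsub
      _ ≤ _ := measure_union_le _ _
      _ ≤ η / 2 + η / 2 := add_le_add
          ((le_iSup (fun P => (ℙ P) {ω | min (δ / 2) 1 < |X P n ω - X' P ω|}) P).trans hn)
          ((le_iSup (fun P => (ℙ P) {ω | M < |X' P ω|}) P).trans hM)
      _ = η := ENNReal.add_halves η
end
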